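/- Let (X, Y) be bivariate normal, each marginal N(μ, σ²) with σ > 0, and correlation ρ ∈ [0,1). Then for any u ∈ ℝ, P(X > u, Y > u) = (1 − Φ((u−μ)/σ))² + (1/(2π)) ∫_0^{arcsin ρ} exp(−((u−μ)²/σ²)·(1 − sin θ)/cos² θ) dθ. In particular, P(X > u, Y > u) is a strictly increasing function of ρ. -/

import Mathlib

open MeasureTheory Set Real

/-- Standard normal c.d.f. -/
noncomputable def stdNormalCdf (x : ℝ) : ℝ :=
  ∫ y in Iio x, (Real.sqrt (2 * π))⁻¹ * Real.exp (-y ^ 2 / 2)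

/-- Orthant probability of a bivariate normal vector with `N(μ,σ²)` marginals
and correlation `ρ`, expressed as the double integral of the bivariate normal
density. -/
noncomputable def orthantProb (μ σ ρ u : ℝ) : ℝ :=
  ∫ x in Ioi u, ∫ y in Ioi u,
    (2 * π * σ ^ 2 * Real.sqrt (1 - ρ ^ 2))⁻¹ *
      Real.exp (-((x - μ) ^ 2 - 2 * ρ * (x - μ) * (y - μ) + (y - μ) ^ 2) /
        (2 * σ ^ 2 * (1 - ρ ^ 2)))

/-- Standard normal density. -/
noncomputable def stdNormalPdf (x : ℝ) : ℝ :=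
  (Real.sqrt (2 * π))⁻¹ * Real.exp (-x ^ 2 / 2)

lemma stdNormalPdf_eq_gaussianPDFReal :
    stdNormalPdf = ProbabilityTheory.gaussianPDFReal 0 1 := by
  funext x
  simp [stdNormalPdf, ProbabilityTheory.gaussianPDFReal]

lemma continuous_stdNormalPdf : Continuous stdNormalPdf := by
  unfold stdNormalPdf
  fun_prop

lemma integrable_stdNormalPdf : Integrable stdNormalPdf := by
  rw [stdNormalPdf_eq_gaussianPDFReal]
  exact ProbabilityTheory.integrable_gaussianPDFReal 0 1

lemma integral_stdNormalPdf : ∫ x, stdNormalPdf x = 1 := by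
  rw [stdNormalPdf_eq_gaussianPDFReal]
  exact ProbabilityTheory.integral_gaussianPDFReal_eq_one 0 one_ne_zero

lemma stdNormalPdf_nonneg (x : ℝ) : 0 ≤ stdNormalPdf x := by
  unfold stdNormalPdf
  positivity

lemma stdNormalPdf_le_one (x : ℝ) : stdNormalPdf x ≤ 1 := by
  unfold stdNormalPdf
  refine mul_le_one₀ (inv_le_one_of_one_le₀ ?_) (Real.exp_nonneg _) ?_
  · rw [Real.one_le_sqrt]
    linarith [Real.pi_gt_three]
  · rw [Real.exp_le_one_iff]
    nlinarith [sq_nonneg x]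

lemma stdNormalPdf_mul_stdNormalPdf (x y : ℝ) :
    stdNormalPdf x * stdNormalPdf y = (2 * π)⁻¹ * Real.exp (-(x ^ 2 + y ^ 2) / 2) := by
  unfold stdNormalPdf
  rw [mul_mul_mul_comm, ← mul_inv, Real.mul_self_sqrt (by positivity), ← Real.exp_add]
  ring_nf

lemma integrable_stdNormalPdf_mul_abs_add (C : ℝ) :
    Integrable fun x => stdNormalPdf x * (|x| + C) := by
  have h := (integrable_mul_exp_neg_mul_sq (b := 1 / 2) (by norm_num)).norm.const_mul
    (Real.sqrt (2 * π))⁻¹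
  refine (h.add (integrable_stdNormalPdf.mul_const C)).congr (ae_of_all _ fun x => ?_)
  simp only [Pi.add_apply, norm_mul, Real.norm_eq_abs, Real.abs_exp, stdNormalPdf]
  ring_nf

lemma stdNormalCdf_eq_integral_Iic (x : ℝ) :
    stdNormalCdf x = ∫ y in Iic x, stdNormalPdf y :=
  integral_Iic_eq_integral_Iio.symm

lemma one_sub_stdNormalCdf (x : ℝ) :
    1 - stdNormalCdf x = ∫ y in Ioi x, stdNormalPdf y := by
  rw [stdNormalCdf_eq_integral_Iic, ← integral_stdNormalPdf,
    ← intervalIntegral.integral_Iic_add_Ioi (b := x) integrable_stdNormalPdf.integrableOn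
      integrable_stdNormalPdf.integrableOn, add_sub_cancel_left]

lemma hasDerivAt_stdNormalCdf (x : ℝ) : HasDerivAt stdNormalCdf (stdNormalPdf x) x := by
  have h : stdNormalCdf = fun t => stdNormalCdf 0 + ∫ y in (0 : ℝ)..t, stdNormalPdf y := by
    funext t
    rw [← intervalIntegral.integral_Iic_sub_Iic integrable_stdNormalPdf.integrableOn
      integrable_stdNormalPdf.integrableOn, stdNormalCdf_eq_integral_Iic,
      stdNormalCdf_eq_integral_Iic]
    ring
  rw [h]
  exact (continuous_stdNormalPdf.integral_hasStrictDerivAt 0 x).hasDerivAt.const_add _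

lemma continuous_stdNormalCdf : Continuous stdNormalCdf :=
  continuous_iff_continuousAt.2 fun x => (hasDerivAt_stdNormalCdf x).continuousAt

lemma abs_one_sub_stdNormalCdf_le_one (x : ℝ) : |1 - stdNormalCdf x| ≤ 1 := by
  rw [one_sub_stdNormalCdf, abs_of_nonneg (integral_nonneg stdNormalPdf_nonneg),
    ← integral_stdNormalPdf]
  exact setIntegral_le_integral integrable_stdNormalPdf (ae_of_all _ stdNormalPdf_nonneg)

lemma integral_Ioi_comp_sub_div (f : ℝ → ℝ) (u m : ℝ) {c : ℝ} (hc : 0 < c) :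
    ∫ x in Ioi u, f ((x - m) / c) = c * ∫ z in Ioi ((u - m) / c), f z := by
  rw [← integral_indicator measurableSet_Ioi, ← integral_indicator measurableSet_Ioi]
  have h : (Ioi u).indicator (fun x => f ((x - m) / c)) =
      fun x => (fun y => (Ioi ((u - m) / c)).indicator f (y / c)) (x - m) := by
    funext x
    simp only [indicator, mem_Ioi, div_lt_div_iff_of_pos_right hc, sub_lt_sub_iff_right]
  rw [h, integral_sub_right_eq_self (fun y => (Ioi ((u - m) / c)).indicator f (y / c)) m,
    Measure.integral_comp_div, abs_of_pos hc, smul_eq_mul]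

/-- Upper orthant probability at `(a, a)` of the standard bivariate normal law with correlation
`sin θ`, obtained by conditioning on the first coordinate. -/
noncomputable def stdOrthantProb (a θ : ℝ) : ℝ :=
  ∫ x in Ioi a, stdNormalPdf x * (1 - stdNormalCdf ((a - Real.sin θ * x) / Real.cos θ))

lemma orthantProb_eq_stdOrthantProb {σ θ : ℝ} (hσ : 0 < σ) (hθ : 0 < Real.cos θ) (μ u : ℝ) :
    orthantProb μ σ (Real.sin θ) u = stdOrthantProb ((u - μ) / σ) θ := by
  have hc : 1 - Real.sin θ ^ 2 = Real.cos θ ^ 2 := by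
    linarith [Real.sin_sq_add_cos_sq θ]
  have hinner (x : ℝ) : ∫ y in Ioi u,
      (2 * π * σ ^ 2 * Real.sqrt (1 - Real.sin θ ^ 2))⁻¹ *
        Real.exp (-((x - μ) ^ 2 - 2 * Real.sin θ * (x - μ) * (y - μ) + (y - μ) ^ 2) /
          (2 * σ ^ 2 * (1 - Real.sin θ ^ 2))) =
      σ⁻¹ * (stdNormalPdf ((x - μ) / σ) * (1 - stdNormalCdf
        (((u - μ) / σ - Real.sin θ * ((x - μ) / σ)) / Real.cos θ))) := by
    have hpt (y : ℝ) : (2 * π * σ ^ 2 * Real.sqrt (1 - Real.sin θ ^ 2))⁻¹ *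
        Real.exp (-((x - μ) ^ 2 - 2 * Real.sin θ * (x - μ) * (y - μ) + (y - μ) ^ 2) /
          (2 * σ ^ 2 * (1 - Real.sin θ ^ 2))) =
        σ⁻¹ * (stdNormalPdf ((x - μ) / σ) * (σ * Real.cos θ)⁻¹) *
          stdNormalPdf ((y - (μ + Real.sin θ * (x - μ))) / (σ * Real.cos θ)) := by
      rw [hc, Real.sqrt_sq hθ.le]
      have hexp : -((x - μ) ^ 2 - 2 * Real.sin θ * (x - μ) * (y - μ) + (y - μ) ^ 2) /
          (2 * σ ^ 2 * Real.cos θ ^ 2) = -(((x - μ) / σ) ^ 2 +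
            ((y - (μ + Real.sin θ * (x - μ))) / (σ * Real.cos θ)) ^ 2) / 2 := by
        field_simp
        rw [← hc]
        ring
      rw [hexp]
      have := stdNormalPdf_mul_stdNormalPdf ((x - μ) / σ)
        ((y - (μ + Real.sin θ * (x - μ))) / (σ * Real.cos θ))
      calc _ = σ⁻¹ * (σ * Real.cos θ)⁻¹ * ((2 * π)⁻¹ * Real.exp (-(((x - μ) / σ) ^ 2 +
            ((y - (μ + Real.sin θ * (x - μ))) / (σ * Real.cos θ)) ^ 2) / 2)) := by
            field_simp
        _ = _ := by rw [← this]; ring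
    simp_rw [hpt]
    rw [integral_const_mul, integral_Ioi_comp_sub_div _ _ _ (mul_pos hσ hθ),
      ← one_sub_stdNormalCdf]
    have harg : (u - (μ + Real.sin θ * (x - μ))) / (σ * Real.cos θ) =
        ((u - μ) / σ - Real.sin θ * ((x - μ) / σ)) / Real.cos θ := by
      field_simp
      ring
    rw [harg]
    field_simp
  unfold orthantProb stdOrthantProb
  simp_rw [hinner]
  rw [integral_const_mul, integral_Ioi_comp_sub_div (fun z => stdNormalPdf z *
    (1 - stdNormalCdf (((u - μ) / σ - Real.sin θ * z) / Real.cos θ))) _ _ hσ]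
  field_simp

lemma stdOrthantProb_zero (a : ℝ) : stdOrthantProb a 0 = (1 - stdNormalCdf a) ^ 2 := by
  simp only [stdOrthantProb, Real.sin_zero, Real.cos_zero, zero_mul, sub_zero, div_one]
  rw [integral_mul_const, ← one_sub_stdNormalCdf, sq]

lemma hasDerivAt_sub_sin_mul_div_cos (a x : ℝ) {θ : ℝ} (hθ : Real.cos θ ≠ 0) :
    HasDerivAt (fun t => (a - Real.sin t * x) / Real.cos t)
      ((Real.sin θ * a - x) / Real.cos θ ^ 2) θ := by
  have h := (((Real.hasDerivAt_sin θ).mul_const x).const_sub a).div (Real.hasDerivAt_cos θ) hθ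
  refine h.congr_deriv ?_
  congr 1
  linear_combination (-x) * Real.sin_sq_add_cos_sq θ

lemma stdNormalPdf_mul_conditional (a x : ℝ) {θ : ℝ} (hθ : Real.cos θ ≠ 0) :
    stdNormalPdf x * stdNormalPdf ((a - Real.sin θ * x) / Real.cos θ) =
      stdNormalPdf a * stdNormalPdf ((x - Real.sin θ * a) / Real.cos θ) := by
  rw [stdNormalPdf_mul_stdNormalPdf, stdNormalPdf_mul_stdNormalPdf]
  congr 3
  field_simp
  linear_combination (a ^ 2 - x ^ 2) * Real.sin_sq_add_cos_sq θ

lemma hasDerivAt_stdNormalPdf (x : ℝ) : HasDerivAt stdNormalPdf (-x * stdNormalPdf x) x := by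
  have h := (((hasDerivAt_pow 2 x).neg.div_const 2).exp).const_mul (Real.sqrt (2 * π))⁻¹
  refine h.congr_deriv ?_
  simp only [stdNormalPdf, Pi.neg_apply]
  push_cast
  ring

lemma tendsto_stdNormalPdf_atTop :
    Filter.Tendsto stdNormalPdf Filter.atTop (nhds 0) := by
  have h : Filter.Tendsto (fun x : ℝ => -x ^ 2 / 2) Filter.atTop Filter.atBot := by
    have := (Filter.tendsto_pow_atTop (α := ℝ) two_ne_zero).atTop_div_const zero_lt_two
    refine (Filter.tendsto_neg_atTop_atBot.comp this).congr fun x => ?_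
    simp [neg_div]
  have h' := (Real.tendsto_exp_atBot.comp h).const_mul (Real.sqrt (2 * π))⁻¹
  rwa [mul_zero] at h'

lemma abs_deriv_integrand_le (a x : ℝ) {t c : ℝ} (hc : 0 < c) (ht : c < Real.cos t) :
    |stdNormalPdf x * (stdNormalPdf ((a - Real.sin t * x) / Real.cos t) *
      ((x - Real.sin t * a) / Real.cos t ^ 2))| ≤
      stdNormalPdf x * (|x| + |a|) * (c ^ 2)⁻¹ := by
  have hct : 0 < Real.cos t := hc.trans ht
  rw [abs_mul, abs_mul, abs_div, abs_of_nonneg (stdNormalPdf_nonneg _),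
    abs_of_nonneg (stdNormalPdf_nonneg _), abs_of_pos (pow_pos hct 2), mul_assoc]
  refine mul_le_mul_of_nonneg_left ?_ (stdNormalPdf_nonneg _)
  have hsa : |x - Real.sin t * a| ≤ |x| + |a| := by
    refine (abs_sub _ _).trans (add_le_add_right ?_ _)
    rw [abs_mul]
    exact mul_le_of_le_one_left (abs_nonneg _) (Real.abs_sin_le_one t)
  calc _ ≤ 1 * (|x - Real.sin t * a| / Real.cos t ^ 2) :=
        mul_le_mul_of_nonneg_right (stdNormalPdf_le_one _) (by positivity)
    _ ≤ (|x| + |a|) / c ^ 2 := by rw [one_mul]; gcongr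
    _ = _ := div_eq_mul_inv _ _

lemma hasDerivAt_stdOrthantProb (a : ℝ) {θ : ℝ} (hθ : 0 < Real.cos θ) :
    HasDerivAt (stdOrthantProb a)
      (1 / (2 * π) * Real.exp (-a ^ 2 * (1 - Real.sin θ) / Real.cos θ ^ 2)) θ := by
  have hcos : Real.cos θ ≠ 0 := hθ.ne'
  have hhalf : 0 < Real.cos θ / 2 := by positivity
  have hs : {t | Real.cos θ / 2 < Real.cos t} ∈ nhds θ :=
    (isOpen_lt continuous_const Real.continuous_cos).mem_nhds (half_lt_self hθ)
  have hF (t : ℝ) : Continuous fun x =>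
      stdNormalPdf x * (1 - stdNormalCdf ((a - Real.sin t * x) / Real.cos t)) :=
    continuous_stdNormalPdf.mul (continuous_const.sub (continuous_stdNormalCdf.comp (by fun_prop)))
  have hF' : Continuous fun x =>
      stdNormalPdf x * (stdNormalPdf ((a - Real.sin θ * x) / Real.cos θ) *
        ((x - Real.sin θ * a) / Real.cos θ ^ 2)) :=
    continuous_stdNormalPdf.mul ((continuous_stdNormalPdf.comp (by fun_prop)).mul (by fun_prop))
  obtain ⟨hint, hderiv⟩ := hasDerivAt_integral_of_dominated_loc_of_deriv_le
    (μ := volume.restrict (Ioi a))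
    (F := fun t x => stdNormalPdf x * (1 - stdNormalCdf ((a - Real.sin t * x) / Real.cos t)))
    (F' := fun t x => stdNormalPdf x * (stdNormalPdf ((a - Real.sin t * x) / Real.cos t) *
        ((x - Real.sin t * a) / Real.cos t ^ 2)))
    (bound := fun x => stdNormalPdf x * (|x| + |a|) * ((Real.cos θ / 2) ^ 2)⁻¹)
    hs (Filter.Eventually.of_forall fun t => (hF t).aestronglyMeasurable)
    (integrable_stdNormalPdf.integrableOn.mono' (hF θ).aestronglyMeasurable
      (ae_of_all _ fun x => by
        rw [Real.norm_eq_abs, abs_mul, abs_of_nonneg (stdNormalPdf_nonneg x)]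
        exact mul_le_of_le_one_right (stdNormalPdf_nonneg x)
          (abs_one_sub_stdNormalCdf_le_one _)))
    hF'.aestronglyMeasurable
    (ae_of_all _ fun x t ht => abs_deriv_integrand_le a x hhalf ht)
    ((integrable_stdNormalPdf_mul_abs_add |a|).mul_const _).integrableOn
    (ae_of_all _ fun x t ht => by
      have hct : Real.cos t ≠ 0 := (hhalf.trans ht).ne'
      refine ((((hasDerivAt_stdNormalCdf _).comp t
        (hasDerivAt_sub_sin_mul_div_cos a x hct)).const_sub 1).const_mul
          (stdNormalPdf x)).congr_deriv ?_
      ring)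
  refine hderiv.congr_deriv ?_
  have hanti (x : ℝ) : HasDerivAt
      (fun x => -(stdNormalPdf a * stdNormalPdf ((x - Real.sin θ * a) / Real.cos θ)))
      (stdNormalPdf x * (stdNormalPdf ((a - Real.sin θ * x) / Real.cos θ) *
        ((x - Real.sin θ * a) / Real.cos θ ^ 2))) x := by
    refine (((hasDerivAt_stdNormalPdf _).comp x (((hasDerivAt_id x).sub_const
      (Real.sin θ * a)).div_const (Real.cos θ))).const_mul (stdNormalPdf a)).neg.congr_deriv ?_
    rw [← mul_assoc (stdNormalPdf x), stdNormalPdf_mul_conditional a x hcos]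
    simp only [id]
    field_simp
  have hlim : Filter.Tendsto
      (fun x => -(stdNormalPdf a * stdNormalPdf ((x - Real.sin θ * a) / Real.cos θ)))
      Filter.atTop (nhds 0) := by
    have := tendsto_stdNormalPdf_atTop.comp ((Filter.tendsto_atTop_add_const_right _
      (-(Real.sin θ * a)) Filter.tendsto_id).atTop_div_const hθ)
    simpa [sub_eq_add_neg, Function.comp_def] using (this.const_mul (stdNormalPdf a)).neg
  rw [integral_Ioi_of_hasDerivAt_of_tendsto' (fun x _ => hanti x) hint hlim, zero_sub, neg_neg,
    stdNormalPdf_mul_stdNormalPdf, one_div]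
  congr 2
  field_simp
  linear_combination (-a ^ 2) * Real.sin_sq_add_cos_sq θ

lemma cos_pos_of_mem_uIcc_arcsin {ρ θ : ℝ} (h0 : -1 < ρ) (h1 : ρ < 1)
    (hθ : θ ∈ uIcc 0 (Real.arcsin ρ)) : 0 < Real.cos θ := by
  have hl := Real.neg_pi_div_two_lt_arcsin.2 h0
  have hu := Real.arcsin_lt_pi_div_two.2 h1
  have hpi := Real.pi_div_two_pos
  refine Real.cos_pos_of_mem_Ioo ⟨?_, ?_⟩
  · exact (lt_min (by linarith) hl).trans_le hθ.1
  · exact hθ.2.trans_lt (max_lt hpi hu)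

lemma intervalIntegrable_exp_sin_cos (b : ℝ) {α β : ℝ}
    (h : ∀ θ ∈ uIcc α β, 0 < Real.cos θ) :
    IntervalIntegrable (fun θ => Real.exp (-b * (1 - Real.sin θ) / Real.cos θ ^ 2))
      volume α β := by
  refine ContinuousOn.intervalIntegrable (ContinuousOn.rexp (ContinuousOn.div (by fun_prop)
    (by fun_prop) fun θ hθ => ?_))
  exact (pow_pos (h θ hθ) 2).ne'

lemma orthantProb_eq (μ : ℝ) {σ : ℝ} (hσ : 0 < σ) (u : ℝ) {ρ : ℝ} (h0 : -1 < ρ) (h1 : ρ < 1) :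
    orthantProb μ σ ρ u = (1 - stdNormalCdf ((u - μ) / σ)) ^ 2 +
      (1 / (2 * π)) * ∫ θ in (0 : ℝ)..(Real.arcsin ρ),
        Real.exp (-((u - μ) ^ 2 / σ ^ 2) * (1 - Real.sin θ) / Real.cos θ ^ 2) := by
  have hcos (θ : ℝ) (hθ : θ ∈ uIcc 0 (Real.arcsin ρ)) := cos_pos_of_mem_uIcc_arcsin h0 h1 hθ
  have hint := intervalIntegrable_exp_sin_cos (((u - μ) / σ) ^ 2) hcos
  have hftc := intervalIntegral.integral_eq_sub_of_hasDerivAt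
    (fun θ hθ => hasDerivAt_stdOrthantProb ((u - μ) / σ) (hcos θ hθ)) (hint.const_mul _)
  rw [intervalIntegral.integral_const_mul, stdOrthantProb_zero,
    ← orthantProb_eq_stdOrthantProb hσ (hcos _ right_mem_uIcc), Real.sin_arcsin h0.le h1.le]
    at hftc
  rw [← div_pow, hftc]
  ring

/-- Sheppard-type formula for the bivariate normal orthant probability with
equal `N(μ,σ²)` marginals and correlation `ρ ∈ [0,1)`:
`P(X > u, Y > u) = (1 − Φ((u−μ)/σ))² + (1/(2π)) ∫_0^{arcsin ρ}
exp(−((u−μ)²/σ²)(1 − sin θ)/cos² θ) dθ`; moreover this probability is strictly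
increasing in `ρ` on `[0,1)`. -/
theorem stmt9 (μ σ : ℝ) (hσ : 0 < σ) (u : ℝ) :
    (∀ ρ : ℝ, ρ ∈ Ico (0 : ℝ) 1 →
      orthantProb μ σ ρ u =
        (1 - stdNormalCdf ((u - μ) / σ)) ^ 2 +
          (1 / (2 * π)) * ∫ θ in (0 : ℝ)..(Real.arcsin ρ),
            Real.exp (-((u - μ) ^ 2 / σ ^ 2) *
              (1 - Real.sin θ) / Real.cos θ ^ 2)) ∧
    StrictMonoOn (fun ρ => orthantProb μ σ ρ u) (Ico (0 : ℝ) 1) := by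
  refine ⟨fun ρ hρ => orthantProb_eq μ hσ u (by linarith [hρ.1]) hρ.2, ?_⟩
  intro r hr s hs hrs
  have hr0 : -1 < r := by linarith [hr.1]
  have hs0 : -1 < s := by linarith [hs.1]
  have hasin : Real.arcsin r < Real.arcsin s :=
    Real.strictMonoOn_arcsin ⟨hr0.le, hr.2.le⟩ ⟨hs0.le, hs.2.le⟩ hrs
  have hir := intervalIntegrable_exp_sin_cos ((u - μ) ^ 2 / σ ^ 2)
    fun θ hθ => cos_pos_of_mem_uIcc_arcsin hr0 hr.2 hθ
  have his := intervalIntegrable_exp_sin_cos ((u - μ) ^ 2 / σ ^ 2)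
    fun θ hθ => cos_pos_of_mem_uIcc_arcsin hs0 hs.2 hθ
  have hpos := intervalIntegral.intervalIntegral_pos_of_pos_on (hir.symm.trans his)
    (fun θ _ => Real.exp_pos _) hasin
  rw [← intervalIntegral.integral_interval_sub_left his hir, sub_pos] at hpos
  simp only [orthantProb_eq μ hσ u hr0 hr.2, orthantProb_eq μ hσ u hs0 hs.2]
  gcongr
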